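/- arXiv:1410.8336 — 7 statements merged into one kernel-verified Lean document; each statement's English description precedes it below -/
import Mathlib

section
/- Let V be a finite type and let A and B be simple graphs on V, and let X, Y ⊆ V. Write N_A(X) for the set of vertices outside X having a neighbor in X in A, and N_A[X] = X ∪ N_A(X). Assume: every vertex of Y is isolated in A; every vertex of X is isolated in B; every edge of A not having both endpoints in N_A[X] is also an edge of B; and every edge of B either is an edge of A not having both endpoints in N_A[X], or has both of its endpoints in N_A(X) ∪ Y. Let Q_A be the subgraph of A induced on N_A[X] and let Q_B be the subgraph of B induced on N_A(X) ∪ Y. Let S_A be a feedback vertex set of A and let S_B ⊆ V satisfy: S_A \ N_A[X] = S_B \ (N_A(X) ∪ Y); the graph Q_B − S_B is acyclic; and for every pair of vertices p, q ∈ N_A(X) (allowing p = q), if there is a walk from p to q in Q_B − S_B, then there is a walk from p to q in Q_A − S_A. Then S_B is a feedback vertex set of B. (Gadget-replacement transfer lemma, stated for simple graphs.) -/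
/-- The (open) neighborhood of a set `X`: vertices outside `X` with a neighbor in `X`. -/
def extNbhd {V : Type*} (A : SimpleGraph V) (X : Set V) : Set V :=
  {v | v ∉ X ∧ ∃ x ∈ X, A.Adj v x}

/-- `ReachIn G W p q`: in the subgraph of `G` induced on `W`, the vertex `p` can reach `q`
(in particular both lie in `W`). -/
def ReachIn {V : Type*} (G : SimpleGraph V) (W : Set V) (p q : V) : Prop :=
  ∃ (hp : p ∈ W) (hq : q ∈ W), (G.induce W).Reachable ⟨p, hp⟩ ⟨q, hq⟩

namespace SimpleGraph

variable {V : Type*}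

lemma adj_spanningCoe_induce {G : SimpleGraph V} {W : Set V} {p q : V} :
    (G.induce W).spanningCoe.Adj p q ↔ G.Adj p q ∧ p ∈ W ∧ q ∈ W := by
  simp [map_adj]

/-- A graph whose edges all lie inside `W` has the same reachability on `W` as its induced
subgraph on `W`. -/
lemma Reachable.induce_of_adj_mem {H : SimpleGraph V} {W : Set V}
    (hH : ∀ p q, H.Adj p q → q ∈ W) {p q : V} (h : H.Reachable p q) (hp : p ∈ W) :
    ∃ hq : q ∈ W, (H.induce W).Reachable ⟨p, hp⟩ ⟨q, hq⟩ := by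
  obtain ⟨w⟩ := h
  induction w with
  | nil => exact ⟨hp, .rfl⟩
  | @cons u v _ huv _ ih =>
    obtain ⟨hq, hr⟩ := ih (hH _ _ huv)
    have huv' : (H.induce W).Adj ⟨u, hp⟩ ⟨v, hH _ _ huv⟩ := huv
    exact ⟨hq, huv'.reachable.trans hr⟩

lemma IsAcyclic.spanningCoe {W : Set V} {G : SimpleGraph V} (h : (G.induce W).IsAcyclic) :
    (G.induce W).spanningCoe.IsAcyclic := by
  rw [isAcyclic_iff_forall_adj_isBridge] at h ⊢
  intro p q hpq
  obtain ⟨hG, hp, hq⟩ := adj_spanningCoe_induce.1 hpq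
  have hb := h (v := ⟨p, hp⟩) (w := ⟨q, hq⟩) hG
  rw [isBridge_iff] at hb ⊢
  refine fun hr ↦ hb ?_
  obtain ⟨_, hr'⟩ := hr.induce_of_adj_mem (W := W)
    (fun a b hab ↦ (adj_spanningCoe_induce.1 (deleteEdges_le _ hab)).2.2) hp
  refine hr'.mono fun a b hab ↦ ?_
  simp only [comap_adj, deleteEdges_adj, Function.Embedding.subtype_apply,
    Set.mem_singleton_iff] at hab ⊢
  refine ⟨(adj_spanningCoe_induce.1 hab.1).1, fun he ↦ hab.2 ?_⟩
  simpa using congrArg (Sym2.map Subtype.val) he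

/-- If `Q` connects all pairs of vertices of `P` that `T` connects, then replacing `T` by `Q` in
`R ⊔ T` preserves reachability between vertices of `P`, when all edges of `R` lie inside `P`. -/
lemma Reachable.sup_replace {R Q T : SimpleGraph V} {P : Set V}
    (hR : ∀ p q, R.Adj p q → q ∈ P)
    (hTQ : ∀ p ∈ P, ∀ q ∈ P, T.Reachable p q → Q.Reachable p q)
    {u v : V} (hu : u ∈ P) (hv : v ∈ P) (h : (R ⊔ T).Reachable u v) : (R ⊔ Q).Reachable u v := by
  suffices ∃ z ∈ P, (R ⊔ Q).Reachable u z ∧ T.Reachable z v by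
    obtain ⟨z, hz, huz, hzv⟩ := this
    exact huz.trans ((hTQ z hz v hv hzv).mono le_sup_right)
  clear hv
  rw [reachable_iff_reflTransGen] at h
  induction h with
  | refl => exact ⟨u, hu, .rfl, .rfl⟩
  | tail _ hbc ih =>
    obtain ⟨z, hz, huz, hzb⟩ := ih
    rcases hbc with hbc | hbc
    · have hzb' := hTQ z hz _ (hR _ _ hbc.symm) hzb
      exact ⟨_, hR _ _ hbc, (huz.trans (hzb'.mono le_sup_right)).trans
        (Adj.reachable (Or.inl hbc)), .rfl⟩
    · exact ⟨z, hz, huz, hzb.trans hbc.reachable⟩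

/-- Replacing `Q` by an acyclic `T` in the acyclic graph `R ⊔ Q` preserves acyclicity, provided
`Q` is edge-disjoint from `R` and connects all pairs of `R`-vertices that `T` connects. -/
lemma IsAcyclic.sup_replace {R Q T : SimpleGraph V} {P : Set V}
    (hRQ : (R ⊔ Q).IsAcyclic) (hT : T.IsAcyclic) (hdisj : ∀ p q, R.Adj p q → ¬ Q.Adj p q)
    (hR : ∀ p q, R.Adj p q → q ∈ P)
    (hTQ : ∀ p ∈ P, ∀ q ∈ P, T.Reachable p q → Q.Reachable p q) : (R ⊔ T).IsAcyclic := by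
  intro u c hc
  by_cases hcT : ∀ e ∈ c.edges, e ∈ T.edgeSet
  · exact hT _ (hc.transfer hcT)
  push Not at hcT
  obtain ⟨e, hec, heT⟩ := hcT
  have heRT := c.edges_subset_edgeSet hec
  induction e with
  | h p q =>
  have hpq : R.Adj p q := heRT.resolve_right heT
  have hnb : ¬ (R ⊔ T).IsBridge s(p, q) := fun hb ↦ hb.notMem_edges_of_isCycle hc hec
  have hb := isAcyclic_iff_forall_adj_isBridge.1 hRQ (Or.inl hpq : (R ⊔ Q).Adj p q)
  rw [isBridge_iff] at hnb hb
  rw [not_not] at hnb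
  refine hb ?_
  have hr : (R.deleteEdges {s(p, q)} ⊔ T).Reachable p q := by
    refine hnb.mono fun a b hab ↦ ?_
    simp only [deleteEdges_adj, sup_adj] at hab ⊢
    tauto
  have hr' := hr.sup_replace (fun a b hab ↦ hR a b (deleteEdges_le _ hab)) hTQ
    (hR _ _ hpq.symm) (hR _ _ hpq)
  refine hr'.mono fun a b hab ↦ ?_
  simp only [deleteEdges_adj, sup_adj] at hab ⊢
  rcases hab with hab | hab
  · exact ⟨Or.inl hab.1, hab.2⟩
  · refine ⟨Or.inr hab, fun he ↦ ?_⟩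
    rcases Sym2.eq_iff.1 (Set.mem_singleton_iff.1 he) with ⟨rfl, rfl⟩ | ⟨rfl, rfl⟩
    · exact hdisj _ _ hpq hab
    · exact hdisj _ _ hpq hab.symm

end SimpleGraph

/-- Gadget-replacement transfer lemma, stated for simple graphs. -/
theorem stmt_1 {V : Type*} [Fintype V]
    (A B : SimpleGraph V) (X Y : Set V)
    (hYiso : ∀ y ∈ Y, ∀ z, ¬ A.Adj y z)
    (hXiso : ∀ x ∈ X, ∀ z, ¬ B.Adj x z)
    (hAB : ∀ p q, A.Adj p q →
      ¬(p ∈ X ∪ extNbhd A X ∧ q ∈ X ∪ extNbhd A X) → B.Adj p q)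
    (hBA : ∀ p q, B.Adj p q →
      (A.Adj p q ∧ ¬(p ∈ X ∪ extNbhd A X ∧ q ∈ X ∪ extNbhd A X)) ∨
      (p ∈ extNbhd A X ∪ Y ∧ q ∈ extNbhd A X ∪ Y))
    (S_A S_B : Set V)
    (hSA : (A.induce S_Aᶜ).IsAcyclic)
    (hdiff : S_A \ (X ∪ extNbhd A X) = S_B \ (extNbhd A X ∪ Y))
    (hQB : (B.induce ((extNbhd A X ∪ Y) \ S_B)).IsAcyclic)
    (hwalk : ∀ p ∈ extNbhd A X, ∀ q ∈ extNbhd A X,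
      ReachIn B ((extNbhd A X ∪ Y) \ S_B) p q →
      ReachIn A ((X ∪ extNbhd A X) \ S_A) p q) :
    (B.induce S_Bᶜ).IsAcyclic := by
  have hX : ∀ p q, A.Adj p q → p ∈ X → q ∈ X ∪ extNbhd A X := fun p q h hp ↦ by
    by_cases hq : q ∈ X
    · exact Or.inl hq
    · exact Or.inr ⟨hq, p, hp, h.symm⟩
  have hNA : ∀ p ∈ extNbhd A X, p ∉ S_B → p ∉ S_A := fun p hp hpS ↦ by
    obtain ⟨h, -⟩ := hwalk p hp p hp ⟨⟨Or.inl hp, hpS⟩, ⟨Or.inl hp, hpS⟩, .rfl⟩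
    exact h.2
  have hA : ∀ p q, A.Adj p q → p ∉ X → p ∉ S_B → p ∉ S_A := fun p q h hpX hpS hpA ↦ by
    by_cases hpN : p ∈ extNbhd A X
    · exact hNA p hpN hpS hpA
    · have : p ∈ S_A \ (X ∪ extNbhd A X) := ⟨hpA, by simp [hpX, hpN]⟩
      rw [hdiff] at this
      exact hpS this.1
  -- the edges of `A` that survive in `B - S_B`
  let R : SimpleGraph V :=
    { Adj p q := A.Adj p q ∧ ¬(p ∈ X ∪ extNbhd A X ∧ q ∈ X ∪ extNbhd A X) ∧ p ∉ S_B ∧ q ∉ S_B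
      symm := ⟨fun p q ⟨h, hn, hp, hq⟩ ↦ ⟨h.symm, fun hpq ↦ hn hpq.symm, hq, hp⟩⟩
      loopless := ⟨fun p h ↦ A.irrefl h.1⟩ }
  let Q := (A.induce ((X ∪ extNbhd A X) \ S_A)).spanningCoe
  let T := (B.induce ((extNbhd A X ∪ Y) \ S_B)).spanningCoe
  have hRX : ∀ p q, R.Adj p q → q ∉ X := fun p q h hq ↦
    h.2.1 ⟨hX q p h.1.symm hq, Or.inl hq⟩
  have hRQ : (R ⊔ Q).IsAcyclic := by
    refine hSA.spanningCoe.anti fun p q h ↦ SimpleGraph.adj_spanningCoe_induce.2 ?_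
    rcases h with h | h
    · exact ⟨h.1, hA p q h.1 (hRX q p h.symm) h.2.2.1, hA q p h.1.symm (hRX p q h) h.2.2.2⟩
    · obtain ⟨h, hp, hq⟩ := SimpleGraph.adj_spanningCoe_induce.1 h
      exact ⟨h, hp.2, hq.2⟩
  have hRT : (R ⊔ T).IsAcyclic := by
    refine hRQ.sup_replace (P := {v | v ∉ Y}) hQB.spanningCoe ?_ ?_ ?_
    · intro p q h h'
      obtain ⟨-, hp, hq⟩ := SimpleGraph.adj_spanningCoe_induce.1 h'
      exact h.2.1 ⟨hp.1, hq.1⟩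
    · exact fun p q h hq ↦ hYiso q hq p h.1.symm
    · intro p hp q hq h
      by_cases hpW : p ∈ (extNbhd A X ∪ Y) \ S_B
      · obtain ⟨hqW, hr⟩ := h.induce_of_adj_mem
          (fun a b hab ↦ (SimpleGraph.adj_spanningCoe_induce.1 hab).2.2) hpW
        rw [SimpleGraph.induce_spanningCoe] at hr
        obtain ⟨_, _, hr'⟩ := hwalk p (hpW.1.resolve_right hp) q (hqW.1.resolve_right hq)
          ⟨hpW, hqW, hr⟩
        exact hr'.map (SimpleGraph.Embedding.spanningCoe _).toHom
      · rw [SimpleGraph.reachable_iff_reflTransGen] at h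
        rcases h.cases_head with rfl | ⟨c, hc, -⟩
        · rfl
        · exact absurd (SimpleGraph.adj_spanningCoe_induce.1 hc).2.1 hpW
  refine (SimpleGraph.IsAcyclic.anti (fun p q h ↦ ?_) hRT).comap
    (SimpleGraph.Embedding.spanningCoe _).toHom Subtype.val_injective
  obtain ⟨h, hp, hq⟩ := SimpleGraph.adj_spanningCoe_induce.1 h
  rcases hBA p q h with ⟨hA', hn⟩ | ⟨hpW, hqW⟩
  · exact Or.inl ⟨hA', hn, hp, hq⟩
  · exact Or.inr (SimpleGraph.adj_spanningCoe_induce.2 ⟨h, ⟨hpW, hp⟩, ⟨hqW, hq⟩⟩)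
end

section
/- Let G be a finite simple graph, A a set of vertices of G, and w1, w2 two distinct vertices of G not in A, such that: (i) no cycle of the graph G − {w1, w2} contains a vertex of A; and (ii) there exists a subgraph Q of G with vertex set A ∪ {w1, w2} such that every vertex x of Q other than w1 satisfies deg_Q(x) ≤ |E(Q)| − |A| − 1. Then for every integer k ≥ 1, G has a feedback vertex set of size at most k if and only if G − w1 has a feedback vertex set of size at most k − 1. (Correctness of Rule meta.) -/
/-- A set `S` is a feedback vertex set of `G` if the subgraph induced on the
complement of `S` is acyclic. `HasFVS G k` means `G` has a feedback vertex set
of size at most `k`. -/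
def HasFVS {V : Type*} (G : SimpleGraph V) (k : ℕ) : Prop :=
  ∃ S : Set V, S.ncard ≤ k ∧ (G.induce Sᶜ).IsAcyclic

namespace SimpleGraph

variable {V : Type*} {G : SimpleGraph V}

lemma induce_isAcyclic_iff {s : Set V} :
    (G.induce s).IsAcyclic ↔
      ∀ (v : V) (c : G.Walk v v), c.IsCycle → ∃ x ∈ c.support, x ∉ s := by
  constructor
  · intro h v c hc
    by_contra! hs
    refine h (c.induce s hs) ?_
    exact .of_map (f := (Embedding.induce s).toHom) ((Walk.map_induce c hs).symm ▸ hc)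
  · intro h v c hc
    obtain ⟨x, hx, hxs⟩ := h _ (c.map (Embedding.induce s).toHom)
      (hc.map (Embedding.induce (G := G) s).injective)
    rw [Walk.support_map, List.mem_map] at hx
    obtain ⟨y, -, rfl⟩ := hx
    exact hxs y.2

lemma IsAcyclic.ncard_edgeSet_lt_card [Finite V] [Nonempty V] (h : G.IsAcyclic) :
    G.edgeSet.ncard < Nat.card V := by
  obtain ⟨T, hle, -, hT⟩ := connected_top.exists_isTree_le_of_le_of_isAcyclic le_top h
  have h1 := (isTree_iff_connected_and_card.mp hT).2
  have h2 := Set.ncard_le_ncard (edgeSet_mono hle) (Set.toFinite _)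
  rw [Nat.card_coe_set_eq] at h1
  omega

namespace Subgraph

lemma ncard_edgeSet_lt_ncard_verts [Finite V] {H : G.Subgraph} (hne : H.verts.Nonempty)
    (h : H.coe.IsAcyclic) : H.edgeSet.ncard < H.verts.ncard := by
  have := hne.to_subtype
  rw [← image_coe_edgeSet_coe,
    Set.ncard_image_of_injective _ (Sym2.map.injective Subtype.val_injective)]
  exact h.ncard_edgeSet_lt_card

lemma ncard_edgeSet_le_deleteVerts_add [Finite V] (H : G.Subgraph) (x : V) :
    H.edgeSet.ncard ≤ (H.deleteVerts {x}).edgeSet.ncard + (H.neighborSet x).ncard := by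
  have hsub : H.edgeSet ⊆ (H.deleteVerts {x}).edgeSet ∪ (fun y => s(x, y)) '' H.neighborSet x := by
    intro e
    induction e with | _ a b => ?_
    intro hab
    rw [Subgraph.mem_edgeSet] at hab
    by_cases ha : a = x
    · subst ha
      exact .inr ⟨b, hab, rfl⟩
    by_cases hb : b = x
    · subst hb
      exact .inr ⟨a, hab.symm, Sym2.eq_swap⟩
    · refine .inl ?_
      rw [Subgraph.mem_edgeSet, deleteVerts_adj]
      exact ⟨hab.fst_mem, ha, hab.snd_mem, hb, hab⟩
  exact (Set.ncard_le_ncard hsub (Set.toFinite _)).trans <|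
    (Set.ncard_union_le _ _).trans (Nat.add_le_add_left (Set.ncard_image_le (Set.toFinite _)) _)

end Subgraph

end SimpleGraph

open SimpleGraph

lemma hasFVS_iff {V : Type*} {G : SimpleGraph V} {k : ℕ} :
    HasFVS G k ↔ ∃ S : Set V, S.ncard ≤ k ∧
      ∀ (v : V) (c : G.Walk v v), c.IsCycle → ∃ x ∈ c.support, x ∈ S := by
  simp [HasFVS, induce_isAcyclic_iff]

lemma hasFVS_induce_compl_singleton_iff {V : Type*} [Finite V] {G : SimpleGraph V} {w : V}
    {k : ℕ} (hk : 1 ≤ k) :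
    HasFVS (G.induce ({w}ᶜ : Set V)) (k - 1) ↔ ∃ S : Set V, w ∈ S ∧ S.ncard ≤ k ∧
      ∀ (v : V) (c : G.Walk v v), c.IsCycle → ∃ x ∈ c.support, x ∈ S := by
  constructor
  · rintro ⟨S, hS, hac⟩
    refine ⟨insert w (Subtype.val '' S), Set.mem_insert _ _, ?_, ?_⟩
    · have h1 := Set.ncard_insert_le w (Subtype.val '' S)
      rw [Set.ncard_image_of_injective _ Subtype.val_injective] at h1
      omega
    · have : (G.induce (insert w (Subtype.val '' S))ᶜ).IsAcyclic := by
        have hmem (x : ↥((insert w (Subtype.val '' S))ᶜ : Set V)) : x.1 ∈ ({w}ᶜ : Set V) :=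
          fun h => x.2 (.inl h)
        refine hac.comap ⟨fun x => ⟨⟨x.1, hmem x⟩, fun h => x.2 (.inr ⟨_, h, rfl⟩)⟩, ?_⟩ ?_
        · intro a b hab
          exact hab
        · intro a b hab
          exact Subtype.ext (congrArg (fun y => y.1.1) hab)
      simpa only [induce_isAcyclic_iff, Set.notMem_compl_iff] using this
  · rintro ⟨S, hw, hS, hcov⟩
    refine ⟨Subtype.val ⁻¹' S, ?_, ?_⟩
    · rw [← Set.ncard_image_of_injective _ Subtype.val_injective,
        Subtype.image_preimage_coe]
      have h1 : ({w}ᶜ ∩ S : Set V) = S \ {w} := by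
        ext x; simp [and_comm]
      rw [h1, Set.ncard_sdiff_singleton_of_mem hw]
      omega
    · have : (G.induce Sᶜ).IsAcyclic := by simpa [induce_isAcyclic_iff] using hcov
      refine this.comap ⟨fun x => ⟨x.1.1, x.2⟩, fun {a b} hab => hab⟩ ?_
      intro a b hab
      exact Subtype.ext (Subtype.ext (congrArg (fun y => y.1) hab))

/-- Correctness of Rule meta, stated for simple graphs. -/
theorem stmt_2 {V : Type*} [Fintype V]
    (G : SimpleGraph V) (A : Set V) (w1 w2 : V)
    (hw12 : w1 ≠ w2) (hw1A : w1 ∉ A) (hw2A : w2 ∉ A)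
    (hcyc : ∀ (a : ↥(({w1, w2} : Set V)ᶜ))
      (c : (G.induce ({w1, w2} : Set V)ᶜ).Walk a a),
      c.IsCycle → ∀ b ∈ c.support, (↑b : V) ∉ A)
    (Q : G.Subgraph)
    (hverts : Q.verts = A ∪ {w1, w2})
    (hdeg : ∀ x ∈ Q.verts, x ≠ w1 →
      ((Q.neighborSet x).ncard : ℤ) ≤ (Q.edgeSet.ncard : ℤ) - (A.ncard : ℤ) - 1)
    (k : ℕ) (hk : 1 ≤ k) :
    HasFVS G k ↔ HasFVS (G.induce ({w1}ᶜ : Set V)) (k - 1) := by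
  rw [hasFVS_induce_compl_singleton_iff hk, hasFVS_iff]
  refine ⟨?_, fun ⟨S, _, h⟩ => ⟨S, h⟩⟩
  rintro ⟨S, hS, hcov⟩
  by_cases hw1S : w1 ∈ S
  · exact ⟨S, hw1S, hS, hcov⟩
  have hcard : 1 < (S ∩ insert w2 A).ncard := by
    by_contra! hle
    obtain ⟨x, hx, hSx⟩ : ∃ x ∈ insert w2 A, S ∩ insert w2 A ⊆ {x} := by
      rcases (S ∩ insert w2 A).eq_empty_or_nonempty with h | ⟨x, hx⟩
      · exact ⟨w2, Set.mem_insert _ _, by simp [h]⟩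
      · exact ⟨x, hx.2, fun y hy =>
          (Set.ncard_le_one (Set.toFinite _)).mp hle y hy x hx⟩
    have hxw1 : x ≠ w1 := by
      rintro rfl
      exact hx.elim hw12 hw1A
    have hvert : Q.verts = insert w1 (insert w2 A) := by
      rw [hverts]; ext; simp
    have hxQ : x ∈ Q.verts := hvert ▸ .inr hx
    have hQ : (Q.deleteVerts {x}).coe.IsAcyclic := by
      have hmem (y : (Q.deleteVerts {x}).verts) : y.1 ∈ Sᶜ := by
        obtain ⟨hy, hyx⟩ := y.2
        rw [hvert] at hy
        rcases hy with hy | hy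
        · exact hy ▸ hw1S
        · exact fun h => hyx (hSx ⟨h, hy⟩)
      have hac : (G.induce Sᶜ).IsAcyclic := by simpa [induce_isAcyclic_iff] using hcov
      refine hac.comap ⟨fun y => ⟨y.1, hmem y⟩, fun {a b} hab => ?_⟩ ?_
      · exact (Q.deleteVerts {x}).adj_sub hab
      · intro a b hab
        exact Subtype.ext (congrArg (fun y => y.1) hab)
    have hne : (Q.deleteVerts {x}).verts.Nonempty := ⟨w1, hvert ▸ .inl rfl, hxw1.symm⟩
    have h1 := Subgraph.ncard_edgeSet_lt_ncard_verts hne hQ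
    have h2 := Q.ncard_edgeSet_le_deleteVerts_add x
    have h3 := hdeg x hxQ hxw1
    rw [Subgraph.deleteVerts_verts, Set.ncard_sdiff_singleton_of_mem hxQ, hvert,
      Set.ncard_insert_of_notMem (by simp [hw12, hw1A]), Set.ncard_insert_of_notMem hw2A] at h1
    omega
  refine ⟨insert w1 (insert w2 (S \ insert w2 A)), Set.mem_insert _ _, ?_, ?_⟩
  · have h1 := Set.ncard_insert_le w1 (insert w2 (S \ insert w2 A))
    have h2 := Set.ncard_insert_le w2 (S \ insert w2 A)
    have h3 := Set.ncard_inter_add_ncard_sdiff_eq_ncard S (insert w2 A)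
    omega
  · intro v c hc
    by_contra! hout
    have hsub : ∀ x ∈ c.support, x ∈ ({w1, w2} : Set V)ᶜ := by
      rintro x hx (rfl | rfl)
      · exact hout x hx (.inl rfl)
      · exact hout x hx (.inr (.inl rfl))
    obtain ⟨x, hx, hxS⟩ := hcov v c hc
    have hxA : x ∈ A := by
      by_contra hxA
      refine hout x hx (.inr (.inr ⟨hxS, ?_⟩))
      rintro (rfl | h)
      · exact hsub x hx (.inr rfl)
      · exact hxA h
    refine hcyc _ (c.induce _ hsub) ?_ ⟨x, hsub x hx⟩ ?_ hxA
    · exact .of_map (f := (Embedding.induce _).toHom) ((Walk.map_induce c hsub).symm ▸ hc)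
    · simpa [Walk.support_induce] using hx
end

section
/- Let G be a finite simple graph containing no 3deg3 configuration, let S be a feedback vertex set of G, and let u, v ∈ S be two distinct vertices. Then there are at most two vertices x ∉ S such that N(x) ∩ S = {u, v} and x has at most one neighbor outside S. (Lemma on the properties of the reduced graph, claim (ii).) -/
/-- A 3deg3 configuration in `G`: five distinct vertices `a, b, c, v, w` such that
both `v` and `w` are adjacent to each of `a, b, c`, and each of `a, b, c` has at
most one neighbor outside `{v, w}`. -/
def Has3deg3Config {V : Type*} (G : SimpleGraph V) : Prop :=
  ∃ a b c v w : V,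
    a ≠ b ∧ a ≠ c ∧ a ≠ v ∧ a ≠ w ∧ b ≠ c ∧ b ≠ v ∧ b ≠ w ∧ c ≠ v ∧ c ≠ w ∧ v ≠ w ∧
    G.Adj v a ∧ G.Adj v b ∧ G.Adj v c ∧ G.Adj w a ∧ G.Adj w b ∧ G.Adj w c ∧
    (G.neighborSet a \ {v, w}).ncard ≤ 1 ∧
    (G.neighborSet b \ {v, w}).ncard ≤ 1 ∧
    (G.neighborSet c \ {v, w}).ncard ≤ 1

/-- Lemma on the properties of the reduced graph, claim (ii): in a graph with no
3deg3 configuration, for a feedback vertex set `S` and distinct `u, v ∈ S`, there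
are at most two vertices `x ∉ S` with `N(x) ∩ S = {u, v}` and at most one
neighbor outside `S`. -/
theorem stmt_6 {V : Type*} [Fintype V]
    (G : SimpleGraph V)
    (hno : ¬ Has3deg3Config G)
    (S : Set V) (hS : (G.induce Sᶜ).IsAcyclic)
    (u v : V) (huS : u ∈ S) (hvS : v ∈ S) (huv : u ≠ v) :
    {x : V | x ∉ S ∧ G.neighborSet x ∩ S = {u, v} ∧
      (G.neighborSet x \ S).ncard ≤ 1}.ncard ≤ 2 := by
  by_contra! h
  obtain ⟨a, b, c, ⟨-, haN, ha⟩, ⟨-, hbN, hb⟩, ⟨-, hcN, hc⟩, hab, hac, hbc⟩ :=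
    (Set.two_lt_ncard_iff (Set.toFinite _)).1 h
  have adj_left : ∀ {x}, G.neighborSet x ∩ S = {u, v} → G.Adj u x := fun {x} hx =>
    (show u ∈ G.neighborSet x ∩ S by simp [hx]).1.symm
  have adj_right : ∀ {x}, G.neighborSet x ∩ S = {u, v} → G.Adj v x := fun {x} hx =>
    (show v ∈ G.neighborSet x ∩ S by simp [hx]).1.symm
  have diff_eq : ∀ {x}, G.neighborSet x ∩ S = {u, v} →
      G.neighborSet x \ {u, v} = G.neighborSet x \ S := fun {x} hx => by
    rw [← hx, Set.sdiff_self_inter]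
  exact hno ⟨a, b, c, u, v, hab, hac, (adj_left haN).ne', (adj_right haN).ne', hbc,
    (adj_left hbN).ne', (adj_right hbN).ne', (adj_left hcN).ne', (adj_right hcN).ne', huv,
    adj_left haN, adj_left hbN, adj_left hcN, adj_right haN, adj_right hbN, adj_right hcN,
    (diff_eq haN).symm ▸ ha, (diff_eq hbN).symm ▸ hb, (diff_eq hcN).symm ▸ hc⟩
end

section
/- Let Q be a finite simple graph on seven distinct vertices u, x1, x2, x3, v, w1, w2 containing the path u–x1–x2–x3–v, and write P = {u, x1, x2, x3, v}. Suppose that every vertex of P is adjacent in Q to w1 or to w2, that w2 has at most two neighbors in P, and that w1 has at least three neighbors in P. Then every set S of vertices such that Q − S is acyclic and |S ∩ V(Q)| ≤ 1 satisfies S ∩ V(Q) = {w1}. (Counting claim from the proof that rules 14–18 are correct.) -/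
/-- An acyclic induced subgraph contains no closed chain of at least three distinct vertices. -/
theorem SimpleGraph.IsAcyclic.not_adj_getLast {V : Type*} {G : SimpleGraph V} {s : Set V}
    (hs : (G.induce s).IsAcyclic) {a : V} {l : List V} (hchain : (a :: l).IsChain G.Adj)
    (hnodup : (a :: l).Nodup) (hlen : 2 ≤ l.length) (hmem : ∀ x ∈ a :: l, x ∈ s) :
    ¬ G.Adj a ((a :: l).getLast (List.cons_ne_nil a l)) := by
  intro hadj
  let p := Walk.ofSupport (a :: l) (List.cons_ne_nil a l) hchain
  have hsupp : p.support = a :: l := Walk.support_ofSupport _ _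
  have hp : p.IsPath := by rw [Walk.isPath_def, hsupp]; exact hnodup
  have hps : ∀ x ∈ p.support, x ∈ s := by rw [hsupp]; exact hmem
  have hp' : (p.induce s hps).IsPath := by
    refine Walk.IsPath.of_map (f := (Embedding.induce s).toHom) ?_
    rw [Walk.map_induce]
    exact hp
  have hadj' : (G.induce s).Adj ⟨a, hps _ p.start_mem_support⟩ ⟨_, hps _ p.end_mem_support⟩ := hadj
  have heq := congrArg (fun q => q.1.length) <|
    (hs.subsingleton_path _ _).elim ⟨p.induce s hps, hp'⟩ (Path.singleton hadj')
  have hlength : (p.induce s hps).length = p.length := by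
    conv_rhs => rw [← Walk.map_induce p hps]
    exact (Walk.length_map _ _).symm
  have hone : (p.induce s hps).length = 1 := heq
  have := p.length_support
  rw [hsupp, List.length_cons] at this
  omega

/-- Among the elements of a set with at least three elements, some element avoids two given
ones. -/
theorem Set.exists_mem_ne_ne_of_three_le_ncard {α : Type*} {s : Set α} (hs : 3 ≤ s.ncard)
    (a b : α) : ∃ x ∈ s, x ≠ a ∧ x ≠ b := by
  have hab : ({a, b} : Set α).ncard < s.ncard := by
    have := Set.ncard_insert_le a {b}
    rw [Set.ncard_singleton] at this
    omega
  obtain ⟨x, hx, hx'⟩ := Set.exists_mem_notMem_of_ncard_lt_ncard hab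
  exact ⟨x, hx, by simpa using hx'⟩

/-- Counting claim from the proof that rules 14–18 are correct: in a graph `Q` on
the seven vertices `u, x1, x2, x3, v, w1, w2` containing the path
`u–x1–x2–x3–v`, where every vertex of `P = {u, x1, x2, x3, v}` is adjacent to
`w1` or to `w2`, `w2` has at most two neighbors in `P` and `w1` has at least
three neighbors in `P`, every set `S` with `Q − S` acyclic and
`|S ∩ V(Q)| ≤ 1` satisfies `S ∩ V(Q) = {w1}`. -/
theorem stmt_11 {V : Type*} [Fintype V]
    (Q : SimpleGraph V) (u x1 x2 x3 v w1 w2 : V)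
    (hnodup : [u, x1, x2, x3, v, w1, w2].Nodup)
    (huniv : (Set.univ : Set V) = {u, x1, x2, x3, v, w1, w2})
    (h1 : Q.Adj u x1) (h2 : Q.Adj x1 x2) (h3 : Q.Adj x2 x3) (h4 : Q.Adj x3 v)
    (hcov : ∀ p ∈ ({u, x1, x2, x3, v} : Set V), Q.Adj p w1 ∨ Q.Adj p w2)
    (hw2 : (Q.neighborSet w2 ∩ {u, x1, x2, x3, v}).ncard ≤ 2)
    (hw1 : 3 ≤ (Q.neighborSet w1 ∩ {u, x1, x2, x3, v}).ncard)
    (S : Set V) (hS : (Q.induce Sᶜ).IsAcyclic)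
    (hcard : (S ∩ {u, x1, x2, x3, v, w1, w2}).ncard ≤ 1) :
    S ∩ {u, x1, x2, x3, v, w1, w2} = {w1} := by
  rw [← huniv, Set.inter_univ] at hcard ⊢
  have hsub : ∀ a ∈ S, ∀ b ∈ S, a = b := fun a ha b hb =>
    (Set.ncard_le_one (Set.toFinite S)).1 hcard a ha b hb
  suffices hw1S : w1 ∈ S from
    Set.eq_singleton_iff_unique_mem.2 ⟨hw1S, fun x hx => hsub x hx w1 hw1S⟩
  by_contra hw1S
  simp only [List.nodup_cons, List.mem_cons, List.not_mem_nil, or_false, not_or,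
    not_false_eq_true, List.nodup_nil, and_true] at hnodup
  have hcycle (a : V) (l : List V) (hchain : (a :: l).IsChain Q.Adj) (hn : (a :: l).Nodup)
      (hlen : 2 ≤ l.length) (hmem : ∀ x ∈ a :: l, x ∉ S) :=
    hS.not_adj_getLast hchain hn hlen hmem
  have hsegment (w : V) (hw : w ∉ S) (hwP : w ∉ ({u, x1, x2, x3, v} : Set V)) :
      (u ∉ S → x1 ∉ S → Q.Adj u w → ¬ Q.Adj x1 w) ∧
      (u ∉ S → x1 ∉ S → x2 ∉ S → Q.Adj u w → ¬ Q.Adj x2 w) ∧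
      (u ∉ S → x1 ∉ S → x2 ∉ S → x3 ∉ S → Q.Adj u w → ¬ Q.Adj x3 w) ∧
      (x1 ∉ S → x2 ∉ S → Q.Adj x1 w → ¬ Q.Adj x2 w) ∧
      (x1 ∉ S → x2 ∉ S → x3 ∉ S → Q.Adj x1 w → ¬ Q.Adj x3 w) ∧
      (x1 ∉ S → x2 ∉ S → x3 ∉ S → v ∉ S → Q.Adj x1 w → ¬ Q.Adj v w) ∧
      (x2 ∉ S → x3 ∉ S → Q.Adj x2 w → ¬ Q.Adj x3 w) ∧
      (x2 ∉ S → x3 ∉ S → v ∉ S → Q.Adj x2 w → ¬ Q.Adj v w) ∧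
      (x3 ∉ S → v ∉ S → Q.Adj x3 w → ¬ Q.Adj v w) := by
    simp only [Set.mem_insert_iff, Set.mem_singleton_iff, not_or] at hwP
    refine ⟨fun _ _ _ hb => hcycle w [u, x1] ?_ ?_ ?_ ?_ hb.symm,
      fun _ _ _ _ hb => hcycle w [u, x1, x2] ?_ ?_ ?_ ?_ hb.symm,
      fun _ _ _ _ _ hb => hcycle w [u, x1, x2, x3] ?_ ?_ ?_ ?_ hb.symm,
      fun _ _ _ hb => hcycle w [x1, x2] ?_ ?_ ?_ ?_ hb.symm,
      fun _ _ _ _ hb => hcycle w [x1, x2, x3] ?_ ?_ ?_ ?_ hb.symm,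
      fun _ _ _ _ _ hb => hcycle w [x1, x2, x3, v] ?_ ?_ ?_ ?_ hb.symm,
      fun _ _ _ hb => hcycle w [x2, x3] ?_ ?_ ?_ ?_ hb.symm,
      fun _ _ _ _ hb => hcycle w [x2, x3, v] ?_ ?_ ?_ ?_ hb.symm,
      fun _ _ _ hb => hcycle w [x3, v] ?_ ?_ ?_ ?_ hb.symm⟩ <;>
    simp [Q.adj_comm w, *]
  have hsix (a b c d : V) (hab : Q.Adj a b) (hcd : Q.Adj c d) (hnd : [w1, a, b, w2, c, d].Nodup)
      (ha : a ∉ S) (hb : b ∉ S) (hc : c ∉ S) (hd : d ∉ S) (hw2S : w2 ∉ S) (haw : Q.Adj a w1)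
      (hbw : Q.Adj b w2) (hcw : Q.Adj c w2) : ¬ Q.Adj d w1 := fun hdw =>
    hcycle w1 [a, b, w2, c, d] (by simp [haw.symm, hcw.symm, *]) hnd (by simp) (by simp [*])
      hdw.symm
  have hw2S {p : V} (hp : p ∈ S) (hpw : p ≠ w2) : w2 ∉ S := fun h => hpw (hsub p hp w2 h)
  have hmany := Set.exists_mem_ne_ne_of_three_le_ncard hw1
  simp only [Set.mem_inter_iff, SimpleGraph.mem_neighborSet, Set.mem_insert_iff,
    Set.mem_singleton_iff, Q.adj_comm w1] at hmany
  simp only [Set.mem_insert_iff, Set.mem_singleton_iff, forall_eq_or_imp, forall_eq] at hcov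
  simp only [Set.mem_insert_iff, Set.mem_singleton_iff] at hsegment
  have hw1_nbr (a b : V) :
      (Q.Adj u w1 ∧ u ≠ a ∧ u ≠ b) ∨ (Q.Adj x1 w1 ∧ x1 ≠ a ∧ x1 ≠ b) ∨
        (Q.Adj x2 w1 ∧ x2 ≠ a ∧ x2 ≠ b) ∨ (Q.Adj x3 w1 ∧ x3 ≠ a ∧ x3 ≠ b) ∨
          (Q.Adj v w1 ∧ v ≠ a ∧ v ≠ b) := by
    obtain ⟨x, ⟨hx, h⟩, hxa, hxb⟩ := hmany a b
    rcases h with rfl | rfl | rfl | rfl | rfl <;> simp [hx, hxa, hxb]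
  clear hmany
  have hsegment_w1 := hsegment w1 hw1S (by grind)
  have hsegment_w2 (h : w2 ∉ S) := hsegment w2 h (by grind)
  clear hsegment hcycle hS hcard hw1 hw2 huniv
  by_cases hx2 : x2 ∈ S
  · have hout {y : V} (hy : x2 ≠ y) : y ∉ S := fun h => hy (hsub x2 hx2 y h)
    have hu := hout (y := u) (by grind)
    have hx1 := hout (y := x1) (by grind)
    have hx3 := hout (y := x3) (by grind)
    have hv := hout (y := v) (by grind)
    have hw2 := hout (y := w2) (by grind)
    have c1 := hsix u x1 x3 v h1 h4 (by simp; grind) hu hx1 hx3 hv hw2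
    have c2 := hsix u x1 v x3 h1 h4.symm (by simp; grind) hu hx1 hv hx3 hw2
    have c3 := hsix x1 u x3 v h1.symm h4 (by simp; grind) hx1 hu hx3 hv hw2
    have c4 := hsix x1 u v x3 h1.symm h4.symm (by simp; grind) hx1 hu hv hx3 hw2
    clear hsix hsub hw2S hsegment_w2
    have := hw1_nbr x2 u
    have := hw1_nbr x2 x1
    have := hw1_nbr x2 x3
    have := hw1_nbr x2 v
    grind
  · clear hsix
    by_cases hx1 : x1 ∈ S
    · have := hw1_nbr x1 u
      grind
    · by_cases hx3 : x3 ∈ S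
      · have := hw1_nbr x3 v
        grind
      · have hend : u ∉ S ∨ v ∉ S := by grind
        have := hw1_nbr u v
        have := hw1_nbr u x1
        have := hw1_nbr u x2
        have := hw1_nbr u x3
        have := hw1_nbr v x1
        have := hw1_nbr v x2
        have := hw1_nbr v x3
        grind
end

section
/- Let G be a finite simple graph in which every vertex has degree at least 3 and which contains no gamma configuration. Suppose G contains the path configuration and that |N(w2) ∩ P| = 2. Let S be a feedback vertex set of G such that S ∩ (P ∪ {w1, w2}) ⊆ P, |S ∩ (P ∪ {w1, w2})| = 2, and Q − S contains no path from u to v. Then in Q − S the vertex w2 is reachable from u or from v. (Claim in the proof of correctness of Rule 15.) -/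
/-- A gamma configuration in `G`: distinct vertices `u, v, w, x` such that `u` has
exactly the three neighbors `v, w, x` and `v` is adjacent to both `w` and `x`. -/
def HasGammaConfig {V : Type*} (G : SimpleGraph V) : Prop :=
  ∃ u v w x : V, u ≠ v ∧ u ≠ w ∧ u ≠ x ∧ v ≠ w ∧ v ≠ x ∧ w ≠ x ∧
    G.neighborSet u = {v, w, x} ∧ G.Adj v w ∧ G.Adj v x

/-- The path configuration: `u0, u, x1, x2, x3, v, v0` form an induced path in this
order, `w1, w2` are two further distinct vertices not among these seven, every
neighbor of a vertex of `P = {u, x1, x2, x3, v}` lying outside `P` belongs to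
`{u0, v0, w1, w2}`, and each of `w1, w2` has at least one neighbor in `P`. -/
structure PathConfig {V : Type*} (G : SimpleGraph V)
    (u0 u x1 x2 x3 v v0 w1 w2 : V) : Prop where
  nodup : [u0, u, x1, x2, x3, v, v0, w1, w2].Nodup
  adj1 : G.Adj u0 u
  adj2 : G.Adj u x1
  adj3 : G.Adj x1 x2
  adj4 : G.Adj x2 x3
  adj5 : G.Adj x3 v
  adj6 : G.Adj v v0
  na1 : ¬ G.Adj u0 x1
  na2 : ¬ G.Adj u0 x2
  na3 : ¬ G.Adj u0 x3
  na4 : ¬ G.Adj u0 v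
  na5 : ¬ G.Adj u0 v0
  na6 : ¬ G.Adj u x2
  na7 : ¬ G.Adj u x3
  na8 : ¬ G.Adj u v
  na9 : ¬ G.Adj u v0
  na10 : ¬ G.Adj x1 x3
  na11 : ¬ G.Adj x1 v
  na12 : ¬ G.Adj x1 v0
  na13 : ¬ G.Adj x2 v
  na14 : ¬ G.Adj x2 v0
  na15 : ¬ G.Adj x3 v0
  closed : ∀ p ∈ ({u, x1, x2, x3, v} : Set V), ∀ y : V, G.Adj p y →
    y ∉ ({u, x1, x2, x3, v} : Set V) → y ∈ ({u0, v0, w1, w2} : Set V)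
  w1nb : ∃ p ∈ ({u, x1, x2, x3, v} : Set V), G.Adj w1 p
  w2nb : ∃ p ∈ ({u, x1, x2, x3, v} : Set V), G.Adj w2 p

namespace SimpleGraph

variable {V : Type*} {G : SimpleGraph V}

/-- The vertices of a triangle cannot all lie in a set inducing an acyclic subgraph. -/
theorem not_isAcyclic_induce_of_triangle {T : Set V} (hT : (G.induce T).IsAcyclic) {a b c : V}
    (ha : a ∈ T) (hb : b ∈ T) (hc : c ∈ T)
    (hab : G.Adj a b) (hbc : G.Adj b c) (hca : G.Adj c a) : False := by
  have h1 : (G.induce T).Adj ⟨a, ha⟩ ⟨b, hb⟩ := hab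
  have h2 : (G.induce T).Adj ⟨b, hb⟩ ⟨c, hc⟩ := hbc
  have h3 : (G.induce T).Adj ⟨c, hc⟩ ⟨a, ha⟩ := hca
  refine hT (.cons h1 (.cons h2 (.cons h3 .nil))) ?_
  have := hab.ne
  have := hbc.ne
  have := hca.ne
  simp [Walk.isCycle_def, Walk.isTrail_def]
  grind

/-- The vertices of a 4-cycle cannot all lie in a set inducing an acyclic subgraph. -/
theorem not_isAcyclic_induce_of_square {T : Set V} (hT : (G.induce T).IsAcyclic) {a b c d : V}
    (ha : a ∈ T) (hb : b ∈ T) (hc : c ∈ T) (hd : d ∈ T) (hac : a ≠ c) (hbd : b ≠ d)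
    (hab : G.Adj a b) (hbc : G.Adj b c) (hcd : G.Adj c d) (hda : G.Adj d a) : False := by
  have h1 : (G.induce T).Adj ⟨a, ha⟩ ⟨b, hb⟩ := hab
  have h2 : (G.induce T).Adj ⟨b, hb⟩ ⟨c, hc⟩ := hbc
  have h3 : (G.induce T).Adj ⟨c, hc⟩ ⟨d, hd⟩ := hcd
  have h4 : (G.induce T).Adj ⟨d, hd⟩ ⟨a, ha⟩ := hda
  refine hT (.cons h1 (.cons h2 (.cons h3 (.cons h4 .nil)))) ?_
  have := hab.ne
  have := hbc.ne
  have := hcd.ne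
  have := hda.ne
  simp [Walk.isCycle_def, Walk.isTrail_def]
  grind

/-- A vertex of degree at least 3 whose neighbors lie in `{a, b, c, d}` is adjacent
to `c` or to `d`. -/
theorem adj_or_adj_of_three_le_ncard {p a b c d : V} (hp : 3 ≤ (G.neighborSet p).ncard)
    (h : ∀ y, G.Adj p y → y = a ∨ y = b ∨ y = c ∨ y = d) : G.Adj c p ∨ G.Adj d p := by
  by_contra! hcd
  have hsub : G.neighborSet p ⊆ {a, b} := fun y hy => by
    have hy : G.Adj p y := hy
    rcases h y hy with rfl | rfl | rfl | rfl
    · simp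
    · simp
    · exact absurd hy.symm hcd.1
    · exact absurd hy.symm hcd.2
  have := Set.ncard_le_ncard hsub (Set.toFinite _)
  have : ({a, b} : Set V).ncard ≤ 2 := (Set.ncard_insert_le a {b}).trans (by simp)
  omega

end SimpleGraph

section ReachIn

variable {V : Type*} {G : SimpleGraph V} {W : Set V}

theorem SimpleGraph.Adj.reachIn {p q : V} (h : G.Adj p q) (hp : p ∈ W) (hq : q ∈ W) :
    ReachIn G W p q :=
  have h' : (G.induce W).Adj ⟨p, hp⟩ ⟨q, hq⟩ := h
  ⟨hp, hq, h'.reachable⟩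

theorem ReachIn.trans {p q r : V} (h : ReachIn G W p q) (h' : ReachIn G W q r) :
    ReachIn G W p r :=
  ⟨h.1, h'.2.1, h.2.2.trans h'.2.2⟩

end ReachIn

/-- In a path configuration inside a graph of minimum degree 3, every vertex of the path
is adjacent to `w1` or to `w2`. -/
theorem PathConfig.adj_or_adj {V : Type*} {G : SimpleGraph V} {u0 u x1 x2 x3 v v0 w1 w2 : V}
    (h : PathConfig G u0 u x1 x2 x3 v v0 w1 w2) (hdeg3 : ∀ z : V, 3 ≤ (G.neighborSet z).ncard)
    {p : V} (hp : p ∈ ({u, x1, x2, x3, v} : Set V)) : G.Adj w1 p ∨ G.Adj w2 p := by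
  have hcl := h.closed p hp
  obtain ⟨_, a1, a2, a3, a4, a5, a6, n1, n2, n3, n4, n5, n6, n7, n8, n9, n10, n11, n12, n13,
    n14, n15, _, _, _⟩ := h
  simp only [Set.mem_insert_iff, Set.mem_singleton_iff] at hp hcl
  have key (a b : V) := SimpleGraph.adj_or_adj_of_three_le_ncard (a := a) (b := b)
    (c := w1) (d := w2) (hdeg3 p)
  have := fun y => G.adj_comm p y
  have := fun y => G.irrefl (v := y)
  rcases hp with rfl | rfl | rfl | rfl | rfl
  · exact key u0 x1 (by grind)
  · exact key u x2 (by grind)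
  · exact key x1 x3 (by grind)
  · exact key x2 v (by grind)
  · exact key x3 v0 (by grind)

/-- Claim in the proof of correctness of Rule 15: if `|N(w2) ∩ P| = 2`,
`S` is a feedback vertex set of `G` with `S ∩ (P ∪ {w1, w2}) ⊆ P`,
`|S ∩ (P ∪ {w1, w2})| = 2`, and `Q − S` contains no path from `u` to `v`,
then in `Q − S` the vertex `w2` is reachable from `u` or from `v`. -/
theorem stmt_12 {V : Type*} [Fintype V]
    (G : SimpleGraph V)
    (hdeg3 : ∀ z : V, 3 ≤ (G.neighborSet z).ncard)
    (hnogamma : ¬ HasGammaConfig G)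
    (u0 u x1 x2 x3 v v0 w1 w2 : V)
    (hpc : PathConfig G u0 u x1 x2 x3 v v0 w1 w2)
    (hw2 : (G.neighborSet w2 ∩ {u, x1, x2, x3, v}).ncard = 2)
    (S : Set V)
    (hS : (G.induce Sᶜ).IsAcyclic)
    (hsub : S ∩ (({u, x1, x2, x3, v} : Set V) ∪ {w1, w2}) ⊆ ({u, x1, x2, x3, v} : Set V))
    (hcard : (S ∩ (({u, x1, x2, x3, v} : Set V) ∪ {w1, w2})).ncard = 2)
    (hnouv : ¬ ReachIn G ((({u, x1, x2, x3, v} : Set V) ∪ {w1, w2}) \ S) u v) :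
    ReachIn G ((({u, x1, x2, x3, v} : Set V) ∪ {w1, w2}) \ S) u w2 ∨
    ReachIn G ((({u, x1, x2, x3, v} : Set V) ∪ {w1, w2}) \ S) v w2 := by
  have nu := hpc.adj_or_adj hdeg3 (p := u) (by simp)
  have n1 := hpc.adj_or_adj hdeg3 (p := x1) (by simp)
  have n2 := hpc.adj_or_adj hdeg3 (p := x2) (by simp)
  have n3 := hpc.adj_or_adj hdeg3 (p := x3) (by simp)
  have nv := hpc.adj_or_adj hdeg3 (p := v) (by simp)
  have hnd := hpc.nodup
  have e1 := hpc.adj2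
  have e2 := hpc.adj3
  have e3 := hpc.adj4
  have e4 := hpc.adj5
  simp only [List.nodup_cons, List.mem_cons, List.not_mem_nil, or_false, not_or,
    not_false_eq_true, List.nodup_nil, and_true] at hnd
  set W := (({u, x1, x2, x3, v} : Set V) ∪ {w1, w2}) \ S with hW
  have hw1S : w1 ∉ S := fun h => by
    have := hsub ⟨h, by simp⟩
    simp only [Set.mem_insert_iff, Set.mem_singleton_iff] at this
    grind
  have hw2S : w2 ∉ S := fun h => by
    have := hsub ⟨h, by simp⟩
    simp only [Set.mem_insert_iff, Set.mem_singleton_iff] at this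
    grind
  obtain ⟨m1, m2, mu, mx1, mx2, mx3, mv⟩ : w1 ∈ W ∧ w2 ∈ W ∧ (u ∉ S → u ∈ W) ∧
      (x1 ∉ S → x1 ∈ W) ∧ (x2 ∉ S → x2 ∈ W) ∧ (x3 ∉ S → x3 ∈ W) ∧ (v ∉ S → v ∈ W) := by
    simp [hW, hw1S, hw2S]
  obtain ⟨a, b, hab, ha, hb, hT⟩ : ∃ a b, a ≠ b ∧ a ∈ ({u, x1, x2, x3, v} : Set V) ∧
      b ∈ ({u, x1, x2, x3, v} : Set V) ∧
      ∀ y ∈ ({u, x1, x2, x3, v} : Set V), y ∈ S ↔ y = a ∨ y = b := by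
    obtain ⟨a, b, hab, h⟩ := Set.ncard_eq_two.mp hcard
    refine ⟨a, b, hab, hsub (h ▸ by simp), hsub (h ▸ by simp), fun y hy => ?_⟩
    rw [← Set.mem_singleton_iff (b := b), ← Set.mem_insert_iff, ← h]
    exact ⟨fun hS => ⟨hS, Or.inl hy⟩, fun hS => hS.1⟩
  have tri (w : V) (hw : w ∉ S) {a b : V} (hab : G.Adj a b) (ha : a ∉ S) (hb : b ∉ S) :
      ¬ (G.Adj w a ∧ G.Adj w b) := fun h =>
    G.not_isAcyclic_induce_of_triangle hS hw ha hb h.1 hab h.2.symm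
  have sq (w : V) (hw : w ∉ S) {a b c : V} (hwb : w ≠ b) (hac : a ≠ c) (hab : G.Adj a b)
      (hbc : G.Adj b c) (ha : a ∉ S) (hb : b ∉ S) (hc : c ∉ S) : ¬ (G.Adj w a ∧ G.Adj w c) :=
    fun h => G.not_isAcyclic_induce_of_square hS hw ha hb hc hwb hac h.1 hab hbc h.2.symm
  have t11 := tri w1 hw1S e1
  have t12 := tri w1 hw1S e2
  have t13 := tri w1 hw1S e3
  have t14 := tri w1 hw1S e4
  have t21 := tri w2 hw2S e1
  have t22 := tri w2 hw2S e2
  have t23 := tri w2 hw2S e3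
  have t24 := tri w2 hw2S e4
  have s12 := sq w1 hw1S (by grind) (by grind) e2 e3
  have s22 := sq w2 hw2S (by grind) (by grind) e2 e3
  have s11 := sq w1 hw1S (by grind) (by grind) e1 e2
  have s21 := sq w2 hw2S (by grind) (by grind) e1 e2
  have s13 := sq w1 hw1S (by grind) (by grind) e3 e4
  have s23 := sq w2 hw2S (by grind) (by grind) e3 e4
  have ru (hu : u ∉ S) (h : G.Adj w2 u) : ReachIn G W u w2 := h.symm.reachIn (mu hu) m2
  have rv (hv : v ∉ S) (h : G.Adj w2 v) : ReachIn G W v w2 := h.symm.reachIn (mv hv) m2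
  have ru1 (hu : u ∉ S) (h1 : x1 ∉ S) (h : G.Adj w2 x1) : ReachIn G W u w2 :=
    (e1.reachIn (mu hu) (mx1 h1)).trans (h.symm.reachIn (mx1 h1) m2)
  have rv3 (hv : v ∉ S) (h3 : x3 ∉ S) (h : G.Adj w2 x3) : ReachIn G W v w2 :=
    (e4.symm.reachIn (mv hv) (mx3 h3)).trans (h.symm.reachIn (mx3 h3) m2)
  have ruv (hu : u ∉ S) (hv : v ∉ S) : ¬ (G.Adj w1 u ∧ G.Adj w1 v) := fun h =>
    hnouv ((h.1.symm.reachIn (mu hu) m1).trans (h.2.reachIn m1 (mv hv)))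
  have long {p q r : V} (hp : p ∈ W) (hq : q ∈ W) (hr : r ∈ W) (hqr : G.Adj q r)
      (h1p : G.Adj w1 p) (h1q : G.Adj w1 q) (h2r : G.Adj w2 r) : ReachIn G W p w2 :=
    (h1p.symm.reachIn hp m1).trans <| (h1q.reachIn m1 hq).trans <|
      (hqr.reachIn hq hr).trans (h2r.symm.reachIn hr m2)
  have lv12 (hv : v ∉ S) (h1 : x1 ∉ S) (h2 : x2 ∉ S) := long (mv hv) (mx1 h1) (mx2 h2) e2
  have lv21 (hv : v ∉ S) (h1 : x1 ∉ S) (h2 : x2 ∉ S) := long (mv hv) (mx2 h2) (mx1 h1) e2.symm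
  have lu23 (hu : u ∉ S) (h2 : x2 ∉ S) (h3 : x3 ∉ S) := long (mu hu) (mx2 h2) (mx3 h3) e3
  have lu32 (hu : u ∉ S) (h2 : x2 ∉ S) (h3 : x3 ∉ S) := long (mu hu) (mx3 h3) (mx2 h2) e3.symm
  have hTu := hT u (by simp)
  have hT1 := hT x1 (by simp)
  have hT2 := hT x2 (by simp)
  have hT3 := hT x3 (by simp)
  have hTv := hT v (by simp)
  simp only [Set.mem_insert_iff, Set.mem_singleton_iff] at ha hb
  clear tri sq long hT mu mx1 mx2 mx3 mv hpc hdeg3 hnogamma hw2 hS hsub hcard hnouv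
  clear_value W
  rcases ha with rfl | rfl | rfl | rfl | rfl <;> rcases hb with rfl | rfl | rfl | rfl | rfl <;>
    grind
end

section
/- Let G be a finite simple graph containing the path configuration. Let S be a feedback vertex set of G such that |S ∩ (P ∪ {w1, w2})| ≥ 2 and Q − S contains a path from u to v. Then S' = (S \ (P ∪ {w1, w2})) ∪ {w1, w2} is a feedback vertex set of G with |S'| ≤ |S|. (Specialization of Lemma 15, case (ii.2), to the graph G itself.) -/
/-- If every edge of `H` lies in `s` and comes from an edge of `H'`, then reachability in `H`
from a vertex of `s` lifts to `H'`. -/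
theorem SimpleGraph.Reachable.lift_of_adj {V : Type*} {H : SimpleGraph V} {s : Set V}
    {H' : SimpleGraph s}
    (h : ∀ a b, H.Adj a b → ∃ (ha : a ∈ s) (hb : b ∈ s), H'.Adj ⟨a, ha⟩ ⟨b, hb⟩)
    {a b : V} (hab : H.Reachable a b) (ha : a ∈ s) :
    ∃ hb : b ∈ s, H'.Reachable ⟨a, ha⟩ ⟨b, hb⟩ := by
  obtain ⟨p⟩ := hab
  induction p with
  | nil => exact ⟨ha, .rfl⟩
  | cons hadj _ ih =>
    obtain ⟨_, hc, hac⟩ := h _ _ hadj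
    obtain ⟨hb, hcb⟩ := ih hc
    exact ⟨hb, hac.reachable.trans hcb⟩

theorem SimpleGraph.adj_spanningCoe_induce_iff {V : Type*} {G : SimpleGraph V} {s : Set V}
    {a b : V} : (G.induce s).spanningCoe.Adj a b ↔ a ∈ s ∧ b ∈ s ∧ G.Adj a b := by
  simp only [SimpleGraph.map_adj, SimpleGraph.comap_adj, Function.Embedding.subtype_apply,
    Subtype.exists]
  grind

theorem SimpleGraph.IsAcyclic.spanningCoe_induce {V : Type*} {G : SimpleGraph V} {s : Set V}
    (h : (G.induce s).IsAcyclic) : (G.induce s).spanningCoe.IsAcyclic := by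
  rw [SimpleGraph.isAcyclic_iff_forall_adj_isBridge] at h ⊢
  intro a b hab hr
  obtain ⟨ha, hb, hadj⟩ := SimpleGraph.adj_spanningCoe_induce_iff.1 hab
  refine h (v := ⟨a, ha⟩) (w := ⟨b, hb⟩) hadj ?_
  refine (SimpleGraph.Reachable.lift_of_adj ?_ hr ha).2
  intro c d hcd
  rw [SimpleGraph.deleteEdges_adj, SimpleGraph.adj_spanningCoe_induce_iff] at hcd
  obtain ⟨⟨hc, hd, hadj'⟩, hne⟩ := hcd
  refine ⟨hc, hd, ?_⟩
  rw [SimpleGraph.deleteEdges_adj]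
  refine ⟨hadj', fun he ↦ hne ?_⟩
  simpa using he

/-- Attaching a pendant vertex `z` at `y` preserves acyclicity, and `z` reaches a third vertex `t`
only if `y` did. -/
theorem SimpleGraph.IsAcyclic.sup_edge_isIsolated {V : Type*} {K : SimpleGraph V} {y z t : V}
    (hK : K.IsAcyclic) (hz : K.IsIsolated z) (hzy : z ≠ y) (hzt : z ≠ t)
    (hyt : ¬ K.Reachable y t) :
    (K ⊔ SimpleGraph.edge y z).IsAcyclic ∧ ¬ (K ⊔ SimpleGraph.edge y z).Reachable z t := by
  have from_z : ∀ {a b}, K.Reachable a b → a = z → b = z := by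
    rintro a b ⟨p⟩ rfl
    cases p with
    | nil => rfl
    | cons h _ => exact (hz _ h).elim
  have key : ∀ {a b}, (K ⊔ SimpleGraph.edge y z).Reachable a b → b = t →
      (a ≠ z → K.Reachable a t) ∧ (a = z → K.Reachable y t) := by
    rintro a b ⟨p⟩ rfl
    induction p with
    | nil => exact ⟨fun _ ↦ .rfl, fun h ↦ (hzt h.symm).elim⟩
    | @cons a c b h _ ih =>
      specialize ih hzt hyt
      rw [SimpleGraph.sup_adj, SimpleGraph.edge_adj] at h
      rcases h with h | ⟨⟨rfl, rfl⟩ | ⟨rfl, rfl⟩, -⟩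
      · have hc : c ≠ z := fun e ↦ hz a (e ▸ h.symm)
        exact ⟨fun _ ↦ h.reachable.trans (ih.1 hc), fun e ↦ (hz c (e ▸ h)).elim⟩
      · exact ⟨fun _ ↦ ih.2 rfl, fun e ↦ (hzy e.symm).elim⟩
      · exact ⟨fun e ↦ (e rfl).elim, fun _ ↦ ih.1 hzy.symm⟩
  exact ⟨hK.sup_edge_of_not_reachable fun h ↦ hzy (from_z h.symm rfl).symm,
    fun h ↦ hyt ((key h rfl).2 rfl)⟩

/-- Joining two disconnected vertices `u0`, `v0` of a forest by a path through five isolated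
vertices gives a forest. -/
theorem SimpleGraph.IsAcyclic.sup_path {V : Type*} {K : SimpleGraph V}
    {u0 u x1 x2 x3 v v0 : V} (hK : K.IsAcyclic) (hnd : [u0, u, x1, x2, x3, v, v0].Nodup)
    (hiso : ∀ p ∈ ({u, x1, x2, x3, v} : Set V), K.IsIsolated p) (hends : ¬ K.Reachable u0 v0) :
    (K ⊔ SimpleGraph.edge u0 u ⊔ SimpleGraph.edge u x1 ⊔ SimpleGraph.edge x1 x2 ⊔
      SimpleGraph.edge x2 x3 ⊔ SimpleGraph.edge x3 v ⊔ SimpleGraph.edge v v0).IsAcyclic := by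
  simp only [List.nodup_cons, List.mem_cons, List.not_mem_nil, not_or, or_false] at hnd
  simp only [Set.mem_insert_iff, Set.mem_singleton_iff, forall_eq_or_imp, forall_eq,
    SimpleGraph.IsIsolated] at hiso
  obtain ⟨h1, r1⟩ := hK.sup_edge_isIsolated (z := u)
    (by intro b; grind) (by grind) (by grind) hends
  obtain ⟨h2, r2⟩ := h1.sup_edge_isIsolated (z := x1)
    (by intro b; simp only [SimpleGraph.sup_adj, SimpleGraph.edge_adj]; grind)
    (by grind) (by grind) r1
  obtain ⟨h3, r3⟩ := h2.sup_edge_isIsolated (z := x2)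
    (by intro b; simp only [SimpleGraph.sup_adj, SimpleGraph.edge_adj]; grind)
    (by grind) (by grind) r2
  obtain ⟨h4, r4⟩ := h3.sup_edge_isIsolated (z := x3)
    (by intro b; simp only [SimpleGraph.sup_adj, SimpleGraph.edge_adj]; grind)
    (by grind) (by grind) r3
  obtain ⟨h5, r5⟩ := h4.sup_edge_isIsolated (z := v)
    (by intro b; simp only [SimpleGraph.sup_adj, SimpleGraph.edge_adj]; grind)
    (by grind) (by grind) r4
  exact h5.sup_edge_of_not_reachable r5

/-- Apart from `w1` and `w2`, a vertex of the path `u, x1, x2, x3, v` is adjacent only to its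
neighbors on the path `u0, u, x1, x2, x3, v, v0`. -/
theorem PathConfig.eq_or_eq_of_adj {V : Type*} {G : SimpleGraph V}
    {u0 u x1 x2 x3 v v0 w1 w2 : V} (hpc : PathConfig G u0 u x1 x2 x3 v v0 w1 w2) {p c : V}
    (hp : p ∈ ({u, x1, x2, x3, v} : Set V)) (hadj : G.Adj p c) (h1 : c ≠ w1) (h2 : c ≠ w2) :
    p = u ∧ (c = u0 ∨ c = x1) ∨ p = x1 ∧ (c = u ∨ c = x2) ∨ p = x2 ∧ (c = x1 ∨ c = x3) ∨
      p = x3 ∧ (c = x2 ∨ c = v) ∨ p = v ∧ (c = x3 ∨ c = v0) := by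
  have hc : c = u ∨ c = x1 ∨ c = x2 ∨ c = x3 ∨ c = v ∨ c = u0 ∨ c = v0 := by
    by_cases hc : c ∈ ({u, x1, x2, x3, v} : Set V)
    · simp only [Set.mem_insert_iff, Set.mem_singleton_iff] at hc
      tauto
    · have := hpc.closed p hp c hadj hc
      simp only [Set.mem_insert_iff, Set.mem_singleton_iff, h1, h2, or_false] at this
      tauto
  have hne := hadj.ne
  have hadj' := hadj.symm
  obtain ⟨-, -, -, -, -, -, -, na1, na2, na3, na4, na5, na6, na7, na8, na9, na10, na11, na12,
    na13, na14, na15, -, -, -⟩ := hpc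
  simp only [Set.mem_insert_iff, Set.mem_singleton_iff] at hp
  rcases hp with hp | hp | hp | hp | hp <;> subst hp <;>
    rcases hc with hc | hc | hc | hc | hc | hc | hc <;> subst hc <;> first | contradiction | simp

/-- In a path configuration whose path survives in the complement of a feedback vertex set `S`,
the ends `u0` and `v0` are not connected outside `S` and the configuration. -/
theorem PathConfig.not_reachable_ends {V : Type*} {G : SimpleGraph V}
    {u0 u x1 x2 x3 v v0 w1 w2 : V} (hpc : PathConfig G u0 u x1 x2 x3 v v0 w1 w2) {S : Set V}
    (hS : (G.induce Sᶜ).IsAcyclic)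
    (huv : ReachIn G ((({u, x1, x2, x3, v} : Set V) ∪ {w1, w2}) \ S) u v) :
    ¬ (G.induce (S ∪ (({u, x1, x2, x3, v} : Set V) ∪ {w1, w2}))ᶜ).spanningCoe.Reachable u0 v0 := by
  intro hr
  have hnd := hpc.nodup
  simp only [List.nodup_cons, List.mem_cons, List.not_mem_nil, not_or, or_false] at hnd
  set Q : Set V := ({u, x1, x2, x3, v} : Set V) ∪ {w1, w2} with hQ
  have huQ : u ∈ Q := by simp [hQ]
  have hvQ : v ∈ Q := by simp [hQ]
  have hu0Q : u0 ∉ Q := by simp [hQ]; grind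
  have hu0 : u0 ∈ (S ∪ Q)ᶜ := by
    obtain ⟨p⟩ := hr
    cases p with
    | nil => grind
    | cons h _ => exact (SimpleGraph.adj_spanningCoe_induce_iff.1 h).1
  obtain ⟨hv0, hr'⟩ := hr.lift_of_adj (H' := G.induce (S ∪ Q)ᶜ)
    (fun a b h ↦ by
      obtain ⟨ha, hb, hab⟩ := SimpleGraph.adj_spanningCoe_induce_iff.1 h
      exact ⟨ha, hb, hab⟩) hu0
  obtain ⟨hu, hv, huv⟩ := huv
  have hu0S : u0 ∈ Sᶜ := fun h ↦ hu0 (Or.inl h)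
  have hv0S : v0 ∈ Sᶜ := fun h ↦ hv0 (Or.inl h)
  have hbridge := (SimpleGraph.isAcyclic_iff_forall_adj_isBridge.1 hS)
    (v := ⟨u0, hu0S⟩) (w := ⟨u, hu.2⟩) hpc.adj1
  rw [SimpleGraph.isBridge_iff] at hbridge
  let f : G.induce (S ∪ Q)ᶜ →g (G.induce Sᶜ).deleteEdges {s(⟨u0, hu0S⟩, ⟨u, hu.2⟩)} :=
    { toFun := fun a ↦ ⟨a, fun h ↦ a.2 (Or.inl h)⟩
      map_rel' := by
        rintro ⟨a, ha⟩ ⟨b, hb⟩ hab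
        rw [SimpleGraph.deleteEdges_adj]
        refine ⟨hab, ?_⟩
        simp
        grind }
  let g : G.induce (Q \ S) →g (G.induce Sᶜ).deleteEdges {s(⟨u0, hu0S⟩, ⟨u, hu.2⟩)} :=
    { toFun := fun a ↦ ⟨a, a.2.2⟩
      map_rel' := by
        rintro ⟨a, ha⟩ ⟨b, hb⟩ hab
        rw [SimpleGraph.deleteEdges_adj]
        refine ⟨hab, ?_⟩
        simp
        grind }
  have hadj : ((G.induce Sᶜ).deleteEdges {s(⟨u0, hu0S⟩, ⟨u, hu.2⟩)}).Adj
      ⟨v0, hv0S⟩ ⟨v, hv.2⟩ := by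
    rw [SimpleGraph.deleteEdges_adj]
    refine ⟨hpc.adj6.symm, ?_⟩
    simp
    grind
  exact hbridge ((hr'.map f).trans (hadj.reachable.trans (huv.map g).symm))

/-- Specialization of Lemma 15, case (ii.2), to the graph `G` itself: if `S` is a
feedback vertex set of `G` with `|S ∩ (P ∪ {w1, w2})| ≥ 2` and `Q − S` contains
a path from `u` to `v`, then `S' = (S \ (P ∪ {w1, w2})) ∪ {w1, w2}` is a
feedback vertex set of `G` with `|S'| ≤ |S|`. -/
theorem stmt_13 {V : Type*} [Fintype V]
    (G : SimpleGraph V)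
    (u0 u x1 x2 x3 v v0 w1 w2 : V)
    (hpc : PathConfig G u0 u x1 x2 x3 v v0 w1 w2)
    (S : Set V)
    (hS : (G.induce Sᶜ).IsAcyclic)
    (hcard : 2 ≤ (S ∩ (({u, x1, x2, x3, v} : Set V) ∪ {w1, w2})).ncard)
    (huv : ReachIn G ((({u, x1, x2, x3, v} : Set V) ∪ {w1, w2}) \ S) u v) :
    (G.induce (((S \ (({u, x1, x2, x3, v} : Set V) ∪ {w1, w2})) ∪ {w1, w2})ᶜ)).IsAcyclic ∧
    ((S \ (({u, x1, x2, x3, v} : Set V) ∪ {w1, w2})) ∪ {w1, w2}).ncard ≤ S.ncard := by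
  constructor
  · have hends := hpc.not_reachable_ends hS huv
    set A : Set V := (S ∪ (({u, x1, x2, x3, v} : Set V) ∪ {w1, w2}))ᶜ with hA
    have hacy : (G.induce A).spanningCoe.IsAcyclic := by
      apply SimpleGraph.IsAcyclic.spanningCoe_induce
      have hsub : A ⊆ Sᶜ := fun a ha h ↦ ha (Or.inl h)
      exact hS.embedding (G.induceHomOfLE hsub)
    have hadjK : ∀ a b, (G.induce A).spanningCoe.Adj a b → a ∈ A ∧ b ∈ A ∧ G.Adj a b :=
      fun a b ↦ SimpleGraph.adj_spanningCoe_induce_iff.1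
    have hKadj : ∀ a b, a ∈ A → b ∈ A → G.Adj a b → (G.induce A).spanningCoe.Adj a b :=
      fun a b ha hb h ↦ SimpleGraph.adj_spanningCoe_induce_iff.2 ⟨ha, hb, h⟩
    generalize (G.induce A).spanningCoe = K at *
    have hsup := hacy.sup_path (hpc.nodup.sublist (by simp))
      (fun p hp q hq ↦ (hadjK p q hq).1 (Or.inr (Or.inl hp))) hends
    refine hsup.comap ⟨Subtype.val, ?_⟩ Subtype.val_injective
    rintro ⟨a, ha⟩ ⟨b, hb⟩ hab
    change G.Adj a b at hab
    have hcover : ∀ c ∈ (S \ (({u, x1, x2, x3, v} : Set V) ∪ {w1, w2}) ∪ {w1, w2})ᶜ,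
        c ∈ A ∨ c ∈ ({u, x1, x2, x3, v} : Set V) := by
      intro c hc
      simp only [Set.mem_compl_iff, Set.mem_union, Set.mem_sdiff, not_or] at hc
      by_cases hcP : c ∈ ({u, x1, x2, x3, v} : Set V)
      · exact Or.inr hcP
      · refine Or.inl ?_
        rintro (hcS | hcP' | hcw)
        · exact hc.1 ⟨hcS, hcP, hc.2⟩
        · exact hcP hcP'
        · exact hc.2 hcw
    have hw : ∀ c ∈ (S \ (({u, x1, x2, x3, v} : Set V) ∪ {w1, w2}) ∪ {w1, w2})ᶜ,
        c ≠ w1 ∧ c ≠ w2 := by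
      intro c hc
      simp only [Set.mem_compl_iff, Set.mem_union, Set.mem_insert_iff,
        Set.mem_singleton_iff] at hc
      tauto
    have hP : ∀ p ∈ ({u, x1, x2, x3, v} : Set V), ∀ c, G.Adj p c → c ≠ w1 ∧ c ≠ w2 →
        (K ⊔ SimpleGraph.edge u0 u ⊔ SimpleGraph.edge u x1 ⊔ SimpleGraph.edge x1 x2 ⊔
          SimpleGraph.edge x2 x3 ⊔ SimpleGraph.edge x3 v ⊔ SimpleGraph.edge v v0).Adj p c := by
      intro p hp c hadj hcw
      have hne := hadj.ne
      simp only [SimpleGraph.sup_adj, SimpleGraph.edge_adj]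
      rcases hpc.eq_or_eq_of_adj hp hadj hcw.1 hcw.2 with
        ⟨rfl, rfl | rfl⟩ | ⟨rfl, rfl | rfl⟩ | ⟨rfl, rfl | rfl⟩ | ⟨rfl, rfl | rfl⟩ |
          ⟨rfl, rfl | rfl⟩ <;> simp [hne]
    rcases hcover a ha with haA | haP
    · rcases hcover b hb with hbA | hbP
      · have := hKadj a b haA hbA hab
        simp [SimpleGraph.sup_adj, this]
      · exact (hP b hbP a hab.symm (hw a ha)).symm
    · exact hP a haP b hab (hw b hb)
  · have h1 := Set.ncard_inter_add_ncard_sdiff_eq_ncard S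
      (({u, x1, x2, x3, v} : Set V) ∪ {w1, w2}) (Set.toFinite _)
    have h2 := Set.ncard_union_le (S \ (({u, x1, x2, x3, v} : Set V) ∪ {w1, w2})) {w1, w2}
    have h3 := Set.ncard_insert_le w1 ({w2} : Set V)
    rw [Set.ncard_singleton] at h3
    omega
end

section
/- Let G be a finite simple graph containing the path configuration. Let S be a feedback vertex set of G such that |S ∩ (P ∪ {w1, w2})| ≥ 3. Then S' = (S \ (P ∪ {w1, w2})) ∪ {u, w1, w2} is a feedback vertex set of G with |S'| ≤ |S|. (Specialization of Lemma 15, case (ii.1), to the graph G itself.) -/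
open SimpleGraph in
/-- Adding to `W` a vertex with at most one neighbor in `W` keeps the induced subgraph acyclic. -/
lemma isAcyclic_induce_insert {V : Type*} {G : SimpleGraph V} {W : Set V} {a : V}
    (hW : (G.induce W).IsAcyclic)
    (ha : ∀ b ∈ W, ∀ c ∈ W, G.Adj a b → G.Adj a c → b = c) :
    (G.induce (insert a W)).IsAcyclic := by
  classical
  have key : ∀ {b : V} (c : G.Walk b b), c.IsCycle → (∀ x ∈ c.support, x ∈ insert a W) →
      a ∈ c.support := by
    intro b c hc hcW
    by_contra hac
    have hmem : ∀ x ∈ c.support, x ∈ W := fun x hx =>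
      (hcW x hx).resolve_left (by rintro rfl; exact hac hx)
    refine hW (c.induce W hmem) (Walk.IsCycle.of_map (f := (Embedding.induce W).toHom) ?_)
    rwa [Walk.map_induce]
  intro b c hc
  let f := (Embedding.induce (G := G) (insert a W)).toHom
  have hf : (c.map f).IsCycle := hc.map Subtype.val_injective
  have hmem : ∀ x ∈ (c.map f).support, x ∈ insert a W := by
    intro x hx
    rw [Walk.support_map, List.mem_map] at hx
    obtain ⟨y, -, rfl⟩ := hx
    exact y.2
  have hmem_a := key _ hf hmem
  have hd := hf.rotate hmem_a
  set d := (c.map f).rotate a hmem_a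
  have hnil := hd.not_nil
  have hdW : ∀ x ∈ d.support, G.Adj a x → x ∈ W := fun x hx hax =>
    (hmem x ((Walk.mem_support_rotate_iff ..).1 hx)).resolve_left hax.ne'
  have hsnd := d.adj_snd hnil
  have hpen := (d.adj_penultimate hnil).symm
  exact hd.snd_ne_penultimate <| ha _ (hdW _ (d.getVert_mem_support _) hsnd) _
    (hdW _ (d.getVert_mem_support _) hpen) hsnd hpen

/-- Specialization of Lemma 15, case (ii.1), to the graph `G` itself: if `S` is a
feedback vertex set of `G` with `|S ∩ (P ∪ {w1, w2})| ≥ 3`, then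
`S' = (S \ (P ∪ {w1, w2})) ∪ {u, w1, w2}` is a feedback vertex set of `G` with
`|S'| ≤ |S|`. -/
theorem stmt_14 {V : Type*} [Fintype V]
    (G : SimpleGraph V)
    (u0 u x1 x2 x3 v v0 w1 w2 : V)
    (hpc : PathConfig G u0 u x1 x2 x3 v v0 w1 w2)
    (S : Set V)
    (hS : (G.induce Sᶜ).IsAcyclic)
    (hcard : 3 ≤ (S ∩ (({u, x1, x2, x3, v} : Set V) ∪ {w1, w2})).ncard) :
    (G.induce (((S \ (({u, x1, x2, x3, v} : Set V) ∪ {w1, w2})) ∪ {u, w1, w2})ᶜ)).IsAcyclic ∧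
    ((S \ (({u, x1, x2, x3, v} : Set V) ∪ {w1, w2})) ∪ {u, w1, w2}).ncard ≤ S.ncard := by
  obtain ⟨-, -, -, -, -, -, -, na1, na2, na3, na4, -, -, -, -, -, na10, na11, na12,
    na13, na14, na15, hclosed, -, -⟩ := hpc
  simp only [Set.mem_insert_iff, Set.mem_singleton_iff] at hclosed
  set Q : Set V := {u, x1, x2, x3, v} ∪ {w1, w2} with hQ
  have hQmem : ∀ y, y ∈ Q ↔ (y = u ∨ y = x1 ∨ y = x2 ∨ y = x3 ∨ y = v) ∨ y = w1 ∨ y = w2 := by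
    intro y; simp only [hQ, Set.mem_union, Set.mem_insert_iff, Set.mem_singleton_iff]
  constructor
  · have h0 : (G.induce (S ∪ Q)ᶜ).IsAcyclic :=
      hS.embedding (G.induceHomOfLE (Set.compl_subset_compl.2 Set.subset_union_left))
    have hout : ∀ y ∈ (S ∪ Q)ᶜ, ¬ ((y = u ∨ y = x1 ∨ y = x2 ∨ y = x3 ∨ y = v) ∨
        y = w1 ∨ y = w2) := fun y hy h => hy (Or.inr ((hQmem y).2 h))
    have nbr : ∀ p, (p = u ∨ p = x1 ∨ p = x2 ∨ p = x3 ∨ p = v) → ∀ y ∈ (S ∪ Q)ᶜ, G.Adj p y →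
        y = u0 ∨ y = v0 := by
      intro p hp y hy hpy
      have hyQ := hout y hy
      rcases hclosed p hp y hpy fun h => hyQ (Or.inl h) with h | h | h
      · exact Or.inl h
      · exact Or.inr h
      · exact absurd (Or.inr h) hyQ
    have hv : ∀ y ∈ (S ∪ Q)ᶜ, G.Adj v y → y = v0 := by
      intro y hy h
      rcases nbr v (by simp) y hy h with rfl | rfl
      · exact absurd h.symm na4
      · rfl
    have hx3 : ∀ y ∈ (S ∪ Q)ᶜ, ¬ G.Adj x3 y := by
      intro y hy h
      rcases nbr x3 (by simp) y hy h with rfl | rfl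
      · exact na3 h.symm
      · exact na15 h
    have hx2 : ∀ y ∈ (S ∪ Q)ᶜ, ¬ G.Adj x2 y := by
      intro y hy h
      rcases nbr x2 (by simp) y hy h with rfl | rfl
      · exact na2 h.symm
      · exact na14 h
    have hx1 : ∀ y ∈ (S ∪ Q)ᶜ, ¬ G.Adj x1 y := by
      intro y hy h
      rcases nbr x1 (by simp) y hy h with rfl | rfl
      · exact na1 h.symm
      · exact na12 h
    have h1 := isAcyclic_induce_insert (a := v) h0
      fun b hb c hc hvb hvc => (hv b hb hvb).trans (hv c hc hvc).symm
    have h2 := isAcyclic_induce_insert (a := x3) h1 (by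
      have : ∀ b ∈ insert v (S ∪ Q)ᶜ, G.Adj x3 b → b = v := fun b hb h =>
        hb.resolve_right fun hb => hx3 b hb h
      exact fun b hb c hc h h' => (this b hb h).trans (this c hc h').symm)
    have h3 := isAcyclic_induce_insert (a := x2) h2 (by
      have : ∀ b ∈ insert x3 (insert v (S ∪ Q)ᶜ), G.Adj x2 b → b = x3 := by
        rintro b (rfl | rfl | hb) h
        · rfl
        · exact absurd h na13
        · exact absurd h (hx2 b hb)
      exact fun b hb c hc h h' => (this b hb h).trans (this c hc h').symm)
    have h4 := isAcyclic_induce_insert (a := x1) h3 (by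
      have : ∀ b ∈ insert x2 (insert x3 (insert v (S ∪ Q)ᶜ)), G.Adj x1 b → b = x2 := by
        rintro b (rfl | rfl | rfl | hb) h
        · rfl
        · exact absurd h na10
        · exact absurd h na11
        · exact absurd h (hx1 b hb)
      exact fun b hb c hc h h' => (this b hb h).trans (this c hc h').symm)
    refine h4.embedding (G.induceHomOfLE fun y hy => ?_)
    simp only [Set.mem_compl_iff, Set.mem_union, Set.mem_sdiff, Set.mem_insert_iff,
      Set.mem_singleton_iff, hQmem] at hy ⊢
    clear * - hy
    tauto
  · have h1 := Set.ncard_union_le (S \ Q) {u, w1, w2}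
    have h2 : ({u, w1, w2} : Set V).ncard ≤ 3 := by
      refine (Set.ncard_insert_le _ _).trans ?_
      have := Set.ncard_insert_le w1 {w2}
      rw [Set.ncard_singleton] at this
      omega
    have h3 := Set.ncard_inter_add_ncard_sdiff_eq_ncard S Q
    omega
end
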